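/- Let G be a finite group, U a type equipped with a total binary operation ·, H a finite subset of U, and f : G → U a function with f(x) ∈ H for all x ∈ G. Let η be a real number with 0 ≤ η < 1/120, and suppose that the number of pairs (x, y) ∈ G × G with f(x·y) = f(x) · f(y) is greater than (1 − η)·|G|². Assume U has enough elements outside H (e.g. U is infinite). Then there exist a finite subset H̃ of U, a binary operation * on H̃ making (H̃, *) a group, and a group homomorphism f̃ : G → H̃ such that: (1) |H̃ \ H| ≤ 30·η·|H̃|; (2) the number of pairs (α, β) ∈ H̃ × H̃ with α * β ≠ α · β is at most 91·η·|H̃|²; and (3) the number of x ∈ G with f̃(x) ≠ f(x) is at most 30·η·|G|. -/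

import Mathlib

open Finset in
theorem card_filter_equiv {α β : Type*} [Fintype α] [Fintype β] (e : α ≃ β) (p : β → Prop)
    [DecidablePred p] : #{x | p (e x)} = #{y | p y} :=
  card_bij (fun x _ => e x) (by simp) (by simp) fun y hy => ⟨e.symm y, by simpa using hy⟩

open Finset in
/-- If a property holds for more than half of the elements of a finite group, every element is a
product of two elements having it. -/
theorem exists_and_inv_mul_of_card_lt {G : Type*} [Group G] [Fintype G] (P : G → Prop)
    [DecidablePred P] (h : 2 * #{x | ¬ P x} < Fintype.card G) (g : G) :
    ∃ x, P x ∧ P (x⁻¹ * g) := by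
  classical
  by_contra! hc
  have h1 : #{x | ¬ P (x⁻¹ * g)} = #{x | ¬ P x} :=
    card_filter_equiv ((Equiv.inv G).trans (Equiv.mulRight g)) (fun x => ¬ P x)
  have h2 : (univ : Finset G) ⊆
      univ.filter (fun x => ¬ P x) ∪ univ.filter (fun x => ¬ P (x⁻¹ * g)) := by
    intro x _
    simp only [mem_union, mem_filter, mem_univ, true_and]
    by_cases hx : P x
    · exact Or.inr (hc x hx)
    · exact Or.inl hx
  have h3 := (card_le_card h2).trans (card_union_le _ _)
  rw [card_univ] at h3
  omega

open Finset in
/-- The number of `y` for which `f` fails to be multiplicative at `(x, y)`. -/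
def mulDefect {G U : Type*} [Group G] [Fintype G] [DecidableEq U] (mul : U → U → U) (f : G → U)
    (x : G) : ℕ :=
  #{y | f (x * y) ≠ mul (f x) (f y)}

open Finset in
/-- The number of `y` at which `f` differs from its left translate by `z`. -/
def shiftDefect {G U : Type*} [Group G] [Fintype G] [DecidableEq U] (f : G → U) (z : G) : ℕ :=
  #{y | f (z * y) ≠ f y}

section Defects

variable {G U : Type*} [Group G] [Fintype G] [DecidableEq U] (mul : U → U → U) (f : G → U)

open Finset in
theorem shiftDefect_mul_inv_le {x x' : G} (h : f x' = f x) :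
    shiftDefect f (x' * x⁻¹) ≤ mulDefect mul f x + mulDefect mul f x' := by
  classical
  unfold shiftDefect mulDefect
  rw [← card_filter_equiv (Equiv.mulLeft x)]
  refine (card_le_card ?_).trans (card_union_le _ _)
  intro y
  simp only [mem_filter, mem_univ, true_and, mem_union]
  simp only [Equiv.coe_mulLeft]
  intro hy
  by_contra! hc
  apply hy
  rw [hc.1, ← h, ← hc.2]
  congr 1
  group

theorem shiftDefect_one : shiftDefect f 1 = 0 := by
  simp [shiftDefect]

open Finset in
theorem shiftDefect_inv (z : G) : shiftDefect f z⁻¹ = shiftDefect f z := by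
  unfold shiftDefect
  rw [← card_filter_equiv (Equiv.mulLeft z)]
  simp [ne_comm]

open Finset in
theorem shiftDefect_mul_le (z w : G) :
    shiftDefect f (z * w) ≤ shiftDefect f z + shiftDefect f w := by
  classical
  unfold shiftDefect
  rw [← card_filter_equiv (Equiv.mulLeft w) (fun y => f (z * y) ≠ f y)]
  refine (card_le_card ?_).trans (card_union_le _ _)
  intro y
  simp only [mem_filter, mem_univ, true_and, mem_union]
  simp only [Equiv.coe_mulLeft]
  intro hy
  by_contra! hc
  exact hy (by rw [mul_assoc, hc.1, hc.2])

open Finset in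
/-- The proportion of disagreement between `f` and a translate is either small or large. -/
theorem agreement_mul_shiftDefect_le (z : G) :
    #{x | f (z * x) = f x} * shiftDefect f z ≤ 2 * ∑ x, mulDefect mul f x := by
  calc #{x | f (z * x) = f x} * shiftDefect f z
      = ∑ x with f (z * x) = f x, shiftDefect f z := by simp
    _ ≤ ∑ x with f (z * x) = f x, (mulDefect mul f x + mulDefect mul f (z * x)) := by
        refine sum_le_sum fun x hx => ?_
        simpa using shiftDefect_mul_inv_le mul f (mem_filter.1 hx).2
    _ ≤ ∑ x, (mulDefect mul f x + mulDefect mul f (z * x)) :=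
        sum_le_sum_of_subset (filter_subset _ _)
    _ = 2 * ∑ x, mulDefect mul f x := by
        have h := Equiv.sum_comp (Equiv.mulLeft z) (mulDefect mul f)
        simp only [Equiv.coe_mulLeft] at h
        rw [sum_add_distrib, h]
        ring

open Finset in
theorem card_mul_shiftDefect_le {z : G} (hz : 2 * shiftDefect f z < Fintype.card G) :
    Fintype.card G * shiftDefect f z ≤ 4 * ∑ x, mulDefect mul f x := by
  have h1 := agreement_mul_shiftDefect_le mul f z
  have h2 : #{x | f (z * x) = f x} + shiftDefect f z = Fintype.card G :=
    card_filter_add_card_filter_not _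
  nlinarith

open Finset in
theorem sum_shiftDefect_conj_le (z : G) :
    ∑ x, shiftDefect f (x * z * x⁻¹) ≤
      2 * ∑ x, mulDefect mul f x + Fintype.card G * shiftDefect f z := by
  classical
  have key (x : G) : shiftDefect f (x * z * x⁻¹) ≤
      mulDefect mul f x + mulDefect mul f x + shiftDefect f z := by
    have h1 : mulDefect mul f x = #{y | f (x * (z * y)) ≠ mul (f x) (f (z * y))} :=
      (card_filter_equiv (Equiv.mulLeft z) (fun y => f (x * y) ≠ mul (f x) (f y))).symm
    nth_rewrite 2 [h1]
    unfold shiftDefect mulDefect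
    rw [← card_filter_equiv (Equiv.mulLeft x)]
    refine (card_le_card ?_).trans
      ((card_union_le _ _).trans (Nat.add_le_add_right (card_union_le _ _) _))
    intro y
    simp only [mem_filter, mem_univ, true_and, mem_union]
    simp only [Equiv.coe_mulLeft]
    intro hy
    by_contra! hc
    apply hy
    rw [hc.1.1, ← hc.2, ← hc.1.2]
    congr 1
    group
  refine (sum_le_sum fun x _ => key x).trans (le_of_eq ?_)
  simp only [sum_add_distrib, sum_const, card_univ, smul_eq_mul]
  ring

/-- The elements whose left translation changes fewer than half of the values of `f`. -/
def almostPeriods (h : 16 * ∑ x, mulDefect mul f x < Fintype.card G ^ 2) : Subgroup G where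
  carrier := {z | 2 * shiftDefect f z < Fintype.card G}
  one_mem' := by
    simp [shiftDefect_one, Fintype.card_pos]
  inv_mem' := by
    intro z hz
    simpa [shiftDefect_inv] using hz
  mul_mem' := by
    intro z w hz hw
    have h1 := card_mul_shiftDefect_le mul f hz
    have h2 := card_mul_shiftDefect_le mul f hw
    have h3 := shiftDefect_mul_le f z w
    simp only [Set.mem_ofPred_eq]
    nlinarith

theorem mem_almostPeriods (h : 16 * ∑ x, mulDefect mul f x < Fintype.card G ^ 2) {z : G} :
    z ∈ almostPeriods mul f h ↔ 2 * shiftDefect f z < Fintype.card G := Iff.rfl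

open Finset in
open scoped Classical in
theorem almostPeriods_normal (h : 16 * ∑ x, mulDefect mul f x < Fintype.card G ^ 2)
    (h' : 48 * ∑ x, mulDefect mul f x < Fintype.card G ^ 2) :
    (almostPeriods mul f h).Normal := by
  set K := almostPeriods mul f h
  set B := ∑ x, mulDefect mul f x with hB
  have hfail (z : K) : Fintype.card G * #{x : G | x * z * x⁻¹ ∉ K} ≤ 12 * B := by
    have h1 := sum_shiftDefect_conj_le mul f (z : G)
    have h2 := card_mul_shiftDefect_le mul f ((mem_almostPeriods mul f h).1 z.2)
    have h3 : #{x : G | x * z * x⁻¹ ∉ K} * Fintype.card G ≤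
        2 * ∑ x, shiftDefect f (x * z * x⁻¹) := by
      calc #{x : G | x * z * x⁻¹ ∉ K} * Fintype.card G
          = ∑ x : G with x * (z : G) * x⁻¹ ∉ K, Fintype.card G := by simp
        _ ≤ ∑ x : G with x * (z : G) * x⁻¹ ∉ K, 2 * shiftDefect f (x * z * x⁻¹) := by
            refine sum_le_sum fun x hx => ?_
            have hx' : ¬ 2 * shiftDefect f (x * z * x⁻¹) < Fintype.card G := (mem_filter.1 hx).2
            omega
        _ ≤ ∑ x, 2 * shiftDefect f (x * z * x⁻¹) := sum_le_sum_of_subset (filter_subset _ _)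
        _ = _ := by rw [mul_sum]
    linarith
  have hhalf (x : G) (hx : 2 * #{z : K | ¬ x * z * x⁻¹ ∈ K} < Fintype.card K) :
      ∀ z ∈ K, x * z * x⁻¹ ∈ K := by
    intro z hz
    obtain ⟨u, hu, hv⟩ := exists_and_inv_mul_of_card_lt _ hx ⟨z, hz⟩
    have := K.mul_mem hu hv
    simpa [mul_assoc] using this
  have hdouble : ∑ x : G, #{z : K | ¬ x * z * x⁻¹ ∈ K} = ∑ z : K, #{x : G | ¬ x * z * x⁻¹ ∈ K} := by
    simp only [card_filter]
    exact sum_comm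
  have hmost : 2 * #{x : G | ¬ ∀ z ∈ K, x * z * x⁻¹ ∈ K} < Fintype.card G := by
    have h1 : #{x : G | ¬ ∀ z ∈ K, x * z * x⁻¹ ∈ K} * Fintype.card K ≤
        2 * ∑ x : G, #{z : K | ¬ x * z * x⁻¹ ∈ K} := by
      calc #{x : G | ¬ ∀ z ∈ K, x * z * x⁻¹ ∈ K} * Fintype.card K
          = ∑ x : G with ¬ ∀ z ∈ K, x * z * x⁻¹ ∈ K, Fintype.card K := by simp
        _ ≤ ∑ x : G with ¬ ∀ z ∈ K, x * z * x⁻¹ ∈ K, 2 * #{z : K | ¬ x * z * x⁻¹ ∈ K} := by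
            refine sum_le_sum fun x hx => ?_
            by_contra! hc
            exact (mem_filter.1 hx).2 (hhalf x hc)
        _ ≤ ∑ x : G, 2 * #{z : K | ¬ x * z * x⁻¹ ∈ K} := sum_le_sum_of_subset (filter_subset _ _)
        _ = _ := by rw [mul_sum]
    have h2 : Fintype.card G * ∑ z : K, #{x : G | ¬ x * z * x⁻¹ ∈ K} ≤
        Fintype.card K * (12 * B) := by
      rw [mul_sum]
      refine (sum_le_sum fun z _ => hfail z).trans (le_of_eq ?_)
      simp
    rw [hdouble] at h1
    have h3 : 0 < Fintype.card K := Fintype.card_pos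
    have h4 : 0 < Fintype.card G := Fintype.card_pos
    have h5 : Fintype.card K * (Fintype.card G * #{x : G | ¬ ∀ z ∈ K, x * z * x⁻¹ ∈ K}) ≤
        Fintype.card K * (24 * B) := by nlinarith
    have h6 := Nat.le_of_mul_le_mul_left h5 h3
    nlinarith
  refine ⟨fun z hz g => ?_⟩
  obtain ⟨x, hx, hy⟩ := exists_and_inv_mul_of_card_lt _ hmost g
  have := hx _ (hy z hz)
  simpa [mul_assoc] using this

end Defects

open Finset in
open scoped Classical in
theorem card_filter_quotient_mk_eq {G : Type*} [Group G] [Fintype G] (K : Subgroup G) (a : G) :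
    #{x : G | (x : G ⧸ K) = a} = Fintype.card K := by
  rw [← card_filter_equiv (Equiv.mulLeft a), Fintype.card_subtype]
  simp [eq_comm (b := (a : G ⧸ K)), QuotientGroup.eq]

open Finset in
open scoped Classical in
theorem sum_comp_quotient_mk {G : Type*} [Group G] [Fintype G] (K : Subgroup G)
    (g : G ⧸ K → ℕ) : ∑ x : G, g x = Fintype.card K * ∑ C, g C := by
  rw [← sum_fiberwise univ (fun x : G => (x : G ⧸ K)), mul_sum]
  refine sum_congr rfl fun C _ => ?_
  obtain ⟨a, rfl⟩ := QuotientGroup.mk_surjective C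
  rw [sum_congr rfl (g := fun _ => g a) fun x hx => by rw [(mem_filter.1 hx).2]]
  simp [card_filter_quotient_mk_eq]

open Finset in
open scoped Classical in
/-- A function into an infinite type that is nearly multiplicative is close to the pullback of an
injection on a quotient, which mostly takes values in any given finite set containing those of
the function. -/
theorem exists_injective_quotient_approx {G U : Type*} [Group G] [Fintype G] [DecidableEq U]
    [Infinite U] (mul : U → U → U) (H : Finset U) (f : G → U) (hf : ∀ x, f x ∈ H)
    (h : 48 * ∑ x, mulDefect mul f x < Fintype.card G ^ 2) :
    ∃ (K : Subgroup G) (_ : K.Normal) (m : G ⧸ K → U), Function.Injective m ∧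
      Fintype.card G * #{x : G | m x ≠ f x} ≤ 8 * ∑ x, mulDefect mul f x ∧
      Fintype.card G * (Nat.card K * (univ.image m \ H).card) ≤
        8 * ∑ x, mulDefect mul f x := by
  classical
  set B := ∑ x, mulDefect mul f x with hB
  set n := Fintype.card G
  have h16 : 16 * B < n ^ 2 := by omega
  have hn := almostPeriods_normal mul f h16 h
  set K := almostPeriods mul f h16 with hK
  have hKpos : 0 < Fintype.card K := Fintype.card_pos
  let cost : G → ℕ := fun x =>
    n * #{w : G | (w : G ⧸ K) = x ∧ f w ≠ f x} + 4 * Fintype.card K * mulDefect mul f x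
  have hswap : ∑ x : G, #{w : G | (w : G ⧸ K) = x ∧ f w ≠ f x} =
      ∑ z : G with z ∈ K, shiftDefect f z := by
    have h1 (x : G) : #{w : G | (w : G ⧸ K) = x ∧ f w ≠ f x} =
        #{z : G | z ∈ K ∧ f (z * x) ≠ f x} := by
      rw [← card_filter_equiv (Equiv.mulRight x)]
      congr 1
      ext z
      simp [QuotientGroup.eq_one_iff]
    simp only [h1, shiftDefect, card_filter, sum_filter]
    rw [sum_comm]
    refine sum_congr rfl fun z _ => ?_
    by_cases hz : z ∈ K <;> simp [hz]
  have hsum : ∑ x, cost x ≤ Fintype.card K * (8 * B) := by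
    have h1 : n * ∑ z : G with z ∈ K, shiftDefect f z ≤ Fintype.card K * (4 * B) := by
      rw [mul_sum]
      refine (sum_le_sum fun z hz => card_mul_shiftDefect_le mul f
        ((mem_almostPeriods mul f h16).1 (mem_filter.1 hz).2)).trans (le_of_eq ?_)
      simp [Fintype.card_subtype, ← hK, ← hB]
    simp only [cost, sum_add_distrib, ← mul_sum, hswap]
    rw [← hB]
    nlinarith
  have hrep (C : G ⧸ K) : ∃ r : G, (r : G ⧸ K) = C ∧
      Fintype.card K * cost r ≤ ∑ x ∈ univ.filter (fun x : G => (x : G ⧸ K) = C), cost x := by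
    obtain ⟨a, rfl⟩ := QuotientGroup.mk_surjective C
    obtain ⟨r, hr, hmin⟩ := exists_min_image (univ.filter fun x : G => (x : G ⧸ K) = a) cost
      ⟨a, by simp⟩
    refine ⟨r, (mem_filter.1 hr).2, ?_⟩
    rw [← card_filter_quotient_mk_eq K a, ← smul_eq_mul]
    exact card_nsmul_le_sum _ _ _ hmin
  choose r hr hrcost using hrep
  have hcost : ∑ C, cost (r C) ≤ 8 * B := by
    refine Nat.le_of_mul_le_mul_left ?_ hKpos
    rw [mul_sum]
    refine (sum_le_sum fun C _ => hrcost C).trans ?_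
    rw [sum_fiberwise]
    exact hsum
  obtain ⟨g, hg, hgH⟩ : ∃ g : G ⧸ K → U, Function.Injective g ∧ ∀ C, g C ∉ H := by
    have : Infinite ((H : Set U)ᶜ : Set U) := H.finite_toSet.infinite_compl.to_subtype
    let φ := (Fintype.equivFin (G ⧸ K)).toEmbedding.trans
      (Fin.valEmbedding.trans (Infinite.natEmbedding ((H : Set U)ᶜ : Set U)))
    exact ⟨fun C => φ C, Subtype.val_injective.comp φ.injective, fun C => (φ C).2⟩
  let m : G ⧸ K → U := fun C => if 4 * mulDefect mul f (r C) < n then f (r C) else g C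
  have hmH (C : G ⧸ K) (hC : m C ∉ H) : n ≤ 4 * mulDefect mul f (r C) := by
    by_contra! hc
    simp only [m, if_pos hc] at hC
    exact hC (hf _)
  refine ⟨K, hn, m, ?_, ?_, ?_⟩
  · intro C D hCD
    simp only [m] at hCD
    split_ifs at hCD with hC hD hD
    · have h1 := shiftDefect_mul_inv_le mul f hCD
      have h2 : r C * (r D)⁻¹ ∈ K := by
        rw [hK, mem_almostPeriods]
        omega
      rw [← hr C, ← hr D]
      rw [← QuotientGroup.eq_one_iff] at h2
      simpa [mul_inv_eq_one] using h2
    · exact absurd (hCD ▸ hf _) (hgH D)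
    · exact absurd (hCD ▸ hf _) (hgH C)
    · exact hg hCD
  · rw [card_eq_sum_card_fiberwise (f := fun x : G => (x : G ⧸ K)) (t := univ)
      (by simp [Set.MapsTo]), mul_sum]
    refine (sum_le_sum fun C _ => ?_).trans hcost
    by_cases hC : 4 * mulDefect mul f (r C) < n
    · refine le_trans ?_ (Nat.le_add_right _ _)
      refine Nat.mul_le_mul_left _ (card_le_card fun x hx => ?_)
      simp only [mem_filter, mem_univ, true_and] at hx ⊢
      obtain ⟨hx1, hx2⟩ := hx
      rw [hx2] at hx1
      simp only [m, if_pos hC] at hx1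
      exact ⟨hx2.trans (hr C).symm, hx1.symm⟩
    · refine le_trans ?_ (Nat.le_add_left _ _)
      have h1 : ((univ.filter fun x : G => m x ≠ f x).filter fun x : G => (x : G ⧸ K) = C).card ≤
          Fintype.card K := by
        rw [← card_filter_quotient_mk_eq K (r C), hr C]
        exact card_le_card (filter_subset_filter _ (filter_subset _ _))
      nlinarith
  · have h1 : (univ.image m \ H).card ≤ #{C | m C ∉ H} := by
      refine (card_le_card ?_).trans (card_image_le (f := m))
      intro u
      simp only [mem_sdiff, mem_image, mem_univ, true_and, mem_filter]
      rintro ⟨⟨C, rfl⟩, hC⟩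
      exact ⟨C, hC, rfl⟩
    rw [Nat.card_eq_fintype_card]
    calc n * (Fintype.card K * (univ.image m \ H).card)
        ≤ n * (Fintype.card K * #{C | m C ∉ H}) := by gcongr
      _ = ∑ C with m C ∉ H, n * Fintype.card K := by
          simp only [sum_const, smul_eq_mul]
          ring
      _ ≤ ∑ C with m C ∉ H, cost (r C) := by
          refine sum_le_sum fun C hC => le_trans ?_ (Nat.le_add_left _ _)
          have := hmH C (mem_filter.1 hC).2
          nlinarith
      _ ≤ ∑ C, cost (r C) := sum_le_sum_of_subset (filter_subset _ _)
      _ ≤ 8 * B := hcost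

open Finset in
open scoped Classical in
/-- Transporting disagreement of `mul` with a quotient group operation from the quotient to the
group. -/
theorem card_disagreement_quotient_le {G U : Type*} [Group G] [Fintype G] [DecidableEq U]
    (mul : U → U → U) (f : G → U) (K : Subgroup G) [K.Normal] (m : G ⧸ K → U) :
    Nat.card K ^ 2 * #{p : (G ⧸ K) × (G ⧸ K) | m (p.1 * p.2) ≠ mul (m p.1) (m p.2)} ≤
      ∑ x, mulDefect mul f x + 3 * (Fintype.card G * #{x : G | m x ≠ f x}) := by
  classical
  set E := #{x : G | m x ≠ f x} with hE
  have h1 : Nat.card K ^ 2 * #{p : (G ⧸ K) × (G ⧸ K) | m (p.1 * p.2) ≠ mul (m p.1) (m p.2)} =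
      ∑ x : G, #{y : G | m (x * y) ≠ mul (m x) (m y)} := by
    have h2 (C : G ⧸ K) : #{y : G | m (C * y) ≠ mul (m C) (m y)} =
        Fintype.card K * #{D | m (C * D) ≠ mul (m C) (m D)} := by
      simp only [card_filter]
      exact sum_comp_quotient_mk K fun D => if m (C * D) ≠ mul (m C) (m D) then 1 else 0
    simp only [h2, ← mul_sum]
    rw [sum_comp_quotient_mk K fun C => #{D | m (C * D) ≠ mul (m C) (m D)}]
    simp only [card_filter, Fintype.sum_prod_type, Nat.card_eq_fintype_card]
    ring
  have h3 (x : G) : #{y : G | m (x * y) ≠ mul (m x) (m y)} ≤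
      mulDefect mul f x + (if m x ≠ f x then Fintype.card G else 0) + E + E := by
    have h4 : #{y : G | m ↑(x * y) ≠ f (x * y)} = E :=
      card_filter_equiv (Equiv.mulLeft x) (fun y : G => m y ≠ f y)
    by_cases hx : m x = f x
    · have h5 : #{y : G | m (x * y) ≠ mul (m x) (m y)} ≤
          mulDefect mul f x + #{y : G | m ↑(x * y) ≠ f (x * y)} + E := by
        refine (card_le_card ?_).trans
          ((card_union_le _ _).trans (Nat.add_le_add_right (card_union_le _ _) _))
        intro y
        simp only [mem_filter, mem_univ, true_and, mem_union]
        intro hy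
        by_contra! hc
        apply hy
        rw [hx, hc.2, ← hc.1.1, ← hc.1.2, QuotientGroup.mk_mul]
      rw [h4] at h5
      simpa [hx] using h5
    · have h5 : #{y : G | m (x * y) ≠ mul (m x) (m y)} ≤ Fintype.card G := card_le_univ _
      rw [if_pos hx]
      omega
  rw [h1]
  refine (sum_le_sum fun x _ => h3 x).trans (le_of_eq ?_)
  simp only [sum_add_distrib, ← sum_filter, sum_const, card_univ, smul_eq_mul, ← hE]
  ring

open Finset in
theorem sum_mulDefect_add {G U : Type*} [Group G] [Fintype G] [DecidableEq U]
    (mul : U → U → U) (f : G → U) :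
    #{p : G × G | f (p.1 * p.2) = mul (f p.1) (f p.2)} + ∑ x, mulDefect mul f x =
      Fintype.card G ^ 2 := by
  have h : ∑ x, mulDefect mul f x = #{p : G × G | ¬ f (p.1 * p.2) = mul (f p.1) (f p.2)} := by
    simp only [mulDefect, card_filter, Fintype.sum_prod_type, ne_eq]
  rw [h, card_filter_add_card_filter_not, card_univ, Fintype.card_prod, sq]


/-- Stability theorem for approximately homomorphic maps (Theorem 2 of
Friedl–Ivanyos–Santha, as stated in the paper). `mul` is the given (not
necessarily associative) binary operation on the ambient set `U`. -/
theorem approx_hom_stability {G U : Type*} [Group G] [Fintype G]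
    [DecidableEq U] [Infinite U]
    (mul : U → U → U) (H : Finset U) (f : G → U) (hf : ∀ x : G, f x ∈ H)
    (η : ℝ) (hη0 : 0 ≤ η) (hη : η < 1 / 120)
    (hcount : ((1 - η) * (Fintype.card G : ℝ) ^ 2 : ℝ) <
      ((Finset.univ.filter
        (fun p : G × G => f (p.1 * p.2) = mul (f p.1) (f p.2))).card : ℝ)) :
    ∃ (Ht : Finset U) (star : U → U → U) (e : U) (inv : U → U) (ft : G → U),
      -- `(Ht, star)` is a group
      e ∈ Ht ∧
      (∀ a ∈ Ht, ∀ b ∈ Ht, star a b ∈ Ht) ∧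
      (∀ a ∈ Ht, inv a ∈ Ht) ∧
      (∀ a ∈ Ht, ∀ b ∈ Ht, ∀ c ∈ Ht, star (star a b) c = star a (star b c)) ∧
      (∀ a ∈ Ht, star e a = a ∧ star a e = a) ∧
      (∀ a ∈ Ht, star (inv a) a = e ∧ star a (inv a) = e) ∧
      -- `ft` is a group homomorphism from `G` to `(Ht, star)`
      (∀ x : G, ft x ∈ Ht) ∧
      (∀ x y : G, ft (x * y) = star (ft x) (ft y)) ∧
      -- (1) `|H̃ \ H| ≤ 30·η·|H̃|`
      (((Ht \ H).card : ℝ) ≤ 30 * η * Ht.card) ∧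
      -- (2) the number of pairs where `star` and `mul` disagree is ≤ 91·η·|H̃|²
      ((((Ht ×ˢ Ht).filter (fun p : U × U => star p.1 p.2 ≠ mul p.1 p.2)).card : ℝ) ≤
        91 * η * (Ht.card : ℝ) ^ 2) ∧
      -- (3) the number of `x` with `ft x ≠ f x` is ≤ 30·η·|G|
      (((Finset.univ.filter (fun x : G => ft x ≠ f x)).card : ℝ) ≤
        30 * η * Fintype.card G) := by
  classical
  have hsplit := sum_mulDefect_add mul f
  set B := ∑ x, mulDefect mul f x with hB
  have hn : (0 : ℝ) < Fintype.card G := by exact_mod_cast Fintype.card_pos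
  have hBη : (B : ℝ) ≤ η * (Fintype.card G : ℝ) ^ 2 := by
    have : (_ : ℝ) = _ := congrArg (Nat.cast (R := ℝ)) hsplit
    push_cast at this
    linarith
  have hB48 : 48 * B < Fintype.card G ^ 2 := by
    have : (48 * B : ℝ) < (Fintype.card G : ℝ) ^ 2 := by
      have := pow_pos hn 2
      nlinarith
    exact_mod_cast this
  obtain ⟨K, hK, m, hm, hE, hout⟩ := exists_injective_quotient_approx mul H f hf hB48
  have hpairs := card_disagreement_quotient_le mul f K m
  rw [← hB] at hE hout hpairs
  have hinv (C : G ⧸ K) : Function.invFun m (m C) = C := Function.leftInverse_invFun hm C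
  have hcard : (Finset.univ.image m).card = Fintype.card (G ⧸ K) := by
    rw [Finset.card_image_of_injective _ hm, Finset.card_univ]
  have hlag : (Fintype.card G : ℝ) = Fintype.card (G ⧸ K) * Nat.card K := by
    rw [← Nat.card_eq_fintype_card, ← Nat.card_eq_fintype_card,
      K.card_eq_card_quotient_mul_card_subgroup]
    push_cast
    rfl
  have hKpos : (0 : ℝ) < Nat.card K := by exact_mod_cast Nat.card_pos
  refine ⟨Finset.univ.image m, fun a b => m (Function.invFun m a * Function.invFun m b), m 1,
    fun a => m (Function.invFun m a)⁻¹, fun x => m x, by simp, by simp, by simp, ?_, ?_, ?_,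
    by simp, ?_, ?_, ?_, ?_⟩
  · simp [hinv, mul_assoc]
  · simp [hinv]
  · simp [hinv]
  · simp [hinv]
  · rw [hcard]
    have h1 : (Fintype.card G * (Nat.card K * (Finset.univ.image m \ H).card) : ℝ) ≤ 8 * B := by
      exact_mod_cast hout
    have h2 : (Fintype.card G * Nat.card K : ℝ) * (Finset.univ.image m \ H).card ≤
        (Fintype.card G * Nat.card K : ℝ) * (8 * η * Fintype.card (G ⧸ K)) := by
      rw [sq, mul_comm (η : ℝ), mul_assoc] at hBη
      nth_rewrite 2 [hlag] at hBη
      linarith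
    have h3 := le_of_mul_le_mul_left h2 (mul_pos hn hKpos)
    have h4 : 0 ≤ η * Fintype.card (G ⧸ K) := by positivity
    linarith
  · rw [hcard]
    have h1 : (((Finset.univ.image m ×ˢ Finset.univ.image m).filter (fun p : U × U =>
        m (Function.invFun m p.1 * Function.invFun m p.2) ≠ mul p.1 p.2)).card) ≤
        (Finset.univ.filter (fun p : (G ⧸ K) × (G ⧸ K) =>
          m (p.1 * p.2) ≠ mul (m p.1) (m p.2))).card := by
      refine (Finset.card_le_card ?_).trans (Finset.card_image_le (f := Prod.map m m))
      rintro ⟨u, v⟩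
      simp only [Finset.mem_filter, Finset.mem_product, Finset.mem_image, Finset.mem_univ,
        true_and, Prod.exists, Prod.map_apply, Prod.mk.injEq]
      rintro ⟨⟨⟨C, rfl⟩, D, rfl⟩, h⟩
      rw [hinv, hinv] at h
      exact ⟨C, D, h, rfl, rfl⟩
    have h2 := (Nat.mul_le_mul_left (Nat.card K ^ 2) h1).trans
      (hpairs.trans (Nat.add_le_add_left (Nat.mul_le_mul_left 3 hE) B))
    rw [← Nat.cast_le (α := ℝ)] at h2
    push_cast at h2
    have h3 := pow_pos hKpos 2
    have h4 : 0 ≤ η * (Fintype.card G : ℝ) ^ 2 := by positivity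
    refine le_of_mul_le_mul_left ?_ h3
    calc _ ≤ _ := h2
      _ ≤ 91 * (η * (Fintype.card G : ℝ) ^ 2) := by linarith
      _ = _ := by
        rw [hlag]
        ring
  · have h1 : (Fintype.card G * (Finset.univ.filter (fun x : G => m x ≠ f x)).card : ℝ) ≤
        8 * B := by exact_mod_cast hE
    have h4 : 0 ≤ η * (Fintype.card G : ℝ) ^ 2 := by positivity
    refine le_of_mul_le_mul_left ?_ hn
    linarith
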